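/- Fix N ≥ 1 and let φ : S¹ → ℝ³ be a smooth embedding. Define Z_N(φ) = Σ_{Γ ∈ G³_N} (I(Γ)(φ) / |Aut(Γ)|) · D(Γ) ∈ A_N, a well-defined element independent of the choices of V-orientations and edge orientations for the representatives (since the product D(Γ)·I(Γ)(φ) is). Then Z_N(−φ) = (−1)^N · Z_N(φ), i.e. the perturbative Chern–Simons expansion satisfies Z(φ*)(ħ) = Z(φ)(−ħ), so the terms of even order cannot distinguish a knot from its mirror image. -/

import Mathlib

/- ## Core: labelled Wilson diagrams (trivalent or with one 4-valent vertex),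
   encoded by an "anchor" equivalence between edge-slots and vertex/component
   coordinates.  External vertices are labelled `Fin n` cyclically along the
   oriented Wilson line, internal vertices by `Fin t`.  Only non-Wilson edges
   are recorded (Wilson edges are the implicit arcs between consecutive
   external labels).  The anchor encodes both the valences and a representative
   of the vertex orientation (V-orientation). -/

noncomputable section

open scoped BigOperators

/-- slot-count of a trivalent Wilson graph: each external vertex carries one
non-Wilson edge-end, each internal vertex three. -/
def triBound (n t : ℕ) : Fin n ⊕ Fin t → ℕ := fun v =>
  match v with
  | .inl _ => 1
  | .inr _ => 3

/-- slot-count of a Wilson graph with a single 4-valent vertex `m`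
(all other vertices trivalent). -/
def quadBound (n t : ℕ) (m : Fin n ⊕ Fin t) : Fin n ⊕ Fin t → ℕ := fun v =>
  if v = m then (match m with | .inl _ => 2 | .inr _ => 4) else triBound n t v

/-- A (V-oriented) Wilson diagram with `n` external and `t` internal vertices and
slot-counts `bd`.  `anch` sends each end `(e, b)` of a non-Wilson edge `e` to the
vertex it is attached to, together with its position in the V-orientation order
of the non-Wilson edge-ends at that vertex. -/
structure BDiag (n t : ℕ) (bd : Fin n ⊕ Fin t → ℕ) where
  E : Type
  [fE : Fintype E]
  [dE : DecidableEq E]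
  anch : E × Bool ≃ ((v : Fin n ⊕ Fin t) × Fin (bd v))
  npos : 0 < n
  /-- connectivity (through non-Wilson edges together with the Wilson line) -/
  conn : (SimpleGraph.fromRel (fun u v =>
      (∃ (e : E) (b : Bool), (anch (e, b)).1 = u ∧ (anch (e, !b)).1 = v) ∨
      (∃ i j : Fin n, u = Sum.inl i ∧ v = Sum.inl j ∧ (i.val + 1) % n = j.val))).Connected

attribute [instance] BDiag.fE BDiag.dE

/-- the vertex at which the end `(e,b)` is attached. -/
def BDiag.ep {n t : ℕ} {bd : Fin n ⊕ Fin t → ℕ} (Γ : BDiag n t bd) (e : Γ.E) (b : Bool) :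
    Fin n ⊕ Fin t := (Γ.anch (e, b)).1

/-- the V-orientation position of the end `(e,b)` at its vertex. -/
def BDiag.cmp {n t : ℕ} {bd : Fin n ⊕ Fin t → ℕ} (Γ : BDiag n t bd) (e : Γ.E) (b : Bool) :
    ℕ := ((Γ.anch (e, b)).2 : ℕ)

/-- trivalent V-oriented Wilson diagrams. -/
abbrev Tri (n t : ℕ) := BDiag n t (triBound n t)

/-- relabelling of vertices by a rotation `k` of the Wilson line and a
permutation `π` of the internal vertices. -/
def vmap {n t : ℕ} (k : Fin n) (π : Equiv.Perm (Fin t)) :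
    Fin n ⊕ Fin t → Fin n ⊕ Fin t := Sum.map (· + k) π

/-- Isomorphisms of (V-oriented) Wilson diagrams: a bijection `ψ` of edges with
end-flips `fl`, a rotation `k` of the Wilson line (preserving its orientation),
a permutation `π` of internal vertices, and for each vertex a permutation `ρ`
of the local V-orientation orders. -/
structure BIso {n t : ℕ} {bd bd' : Fin n ⊕ Fin t → ℕ}
    (Γ : BDiag n t bd) (Γ' : BDiag n t bd') where
  ψ : Γ.E ≃ Γ'.E
  fl : Γ.E → Bool
  k : Fin n
  π : Equiv.Perm (Fin t)
  ρ : (v : Fin n ⊕ Fin t) → Fin (bd v) ≃ Fin (bd' (vmap k π v))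
  hanch : ∀ (e : Γ.E) (b : Bool),
    Γ'.anch (ψ e, xor (fl e) b) =
      ⟨vmap k π (Γ.anch (e, b)).1, ρ (Γ.anch (e, b)).1 (Γ.anch (e, b)).2⟩

/-- the sign comparing the V-orientation of the target with the V-orientation
induced by the isomorphism (product over all vertices of the signatures of the
local reorderings). -/
noncomputable def BIso.sign {n t : ℕ} {bd bd' : Fin n ⊕ Fin t → ℕ}
    {Γ : BDiag n t bd} {Γ' : BDiag n t bd'} (φ : BIso Γ Γ') : ℤˣ :=
  ∏ v : Fin n ⊕ Fin t, Equiv.Perm.sign ((φ.ρ v).trans (finCongr (by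
    simpa using (Fintype.card_congr (φ.ρ v)).symm)))

/-- Automorphisms of the underlying Wilson graph (forgetting V-orientations):
pairs `(ρ, σ)` of a vertex bijection preserving the oriented Wilson line and an
edge bijection intertwining the boundary maps. -/
structure GAuto {n t : ℕ} {bd : Fin n ⊕ Fin t → ℕ} (Γ : BDiag n t bd) where
  ψ : Equiv.Perm Γ.E
  k : Fin n
  π : Equiv.Perm (Fin t)
  hep : ∀ e : Γ.E,
    (Γ.ep (ψ e) false = vmap k π (Γ.ep e false) ∧ Γ.ep (ψ e) true = vmap k π (Γ.ep e true)) ∨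
    (Γ.ep (ψ e) false = vmap k π (Γ.ep e true) ∧ Γ.ep (ψ e) true = vmap k π (Γ.ep e false))

/-- Isomorphisms of the underlying Wilson graphs (not respecting V-orientation). -/
structure UIso {n t : ℕ} {bd bd' : Fin n ⊕ Fin t → ℕ}
    (Γ : BDiag n t bd) (Γ' : BDiag n t bd') where
  ψ : Γ.E ≃ Γ'.E
  fl : Γ.E → Bool
  k : Fin n
  π : Equiv.Perm (Fin t)
  hep : ∀ (e : Γ.E) (b : Bool), Γ'.ep (ψ e) (xor (fl e) b) = vmap k π (Γ.ep e b)

/-- the interior of a Wilson diagram, as a simple graph on its vertices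
(adjacency through non-Wilson edges only). -/
def intG {n t : ℕ} {bd : Fin n ⊕ Fin t → ℕ} (Γ : BDiag n t bd) :
    SimpleGraph (Fin n ⊕ Fin t) :=
  SimpleGraph.fromRel (fun u v => ∃ (e : Γ.E) (b : Bool), Γ.ep e b = u ∧ Γ.ep e (!b) = v)

end
/- ## Collapse of an admissible edge of a trivalent Wilson diagram onto a
   diagram with one 4-valent vertex (the graphs `δ_e Γ`), with the induced
   V-orientation (figs. 5-7 of Altschuler-Freidel), stated as predicates. -/

noncomputable section

/-- induced V-orientation position at the new 4-valent internal vertex, for the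
collapse of an internal edge `e` with ends at `uu`, `vv` (concatenation of the
cyclic orders at the two endpoints of `e`, starting after `e`). -/
def indCmpInt {n t : ℕ} (Γ : Tri n (t+1)) (e : Γ.E) (uu vv : Fin (t+1))
    (f : Γ.E) (b : Bool) : ℕ :=
  if Γ.ep f b = Sum.inr uu then (Γ.cmp f b + 3 - Γ.cmp e false) % 3 - 1
  else if Γ.ep f b = Sum.inr vv then (Γ.cmp f b + 3 - Γ.cmp e true) % 3 + 1
  else Γ.cmp f b

/-- Collapse of a non-Wilson edge `e` of `Γ` joining two internal vertices
`uu ≠ vv`, producing `Δ` (which has a distinguished 4-valent internal vertex).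
The V-orientation of `Δ` agrees with the induced one up to an even correction. -/
structure CollapseInt {n t : ℕ} {m : Fin n ⊕ Fin t} (Γ : Tri n (t+1)) (e : Γ.E)
    (Δ : BDiag n t (quadBound n t m)) where
  uu : Fin (t+1)
  vv : Fin (t+1)
  hu : Γ.ep e false = Sum.inr uu
  hv : Γ.ep e true = Sum.inr vv
  hne : uu ≠ vv
  x : Fin t
  hm : m = Sum.inr x
  μ : Fin (t+1) → Fin t
  hμu : μ uu = x
  hμv : μ vv = x
  hinj : ∀ a b : Fin (t+1), a ≠ vv → b ≠ vv → μ a = μ b → a = b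
  hsurj : Function.Surjective μ
  k : Fin n
  φE : {f : Γ.E // f ≠ e} ≃ Δ.E
  g : Γ.E → Bool
  hep : ∀ (f : {f : Γ.E // f ≠ e}) (b : Bool),
    Δ.ep (φE f) (xor (g f.1) b) = Sum.map (· + k) μ (Γ.ep f.1 b)
  ρ : (v : Fin n ⊕ Fin t) → Equiv.Perm (Fin (quadBound n t m v))
  hsgn : ∏ v : Fin n ⊕ Fin t, Equiv.Perm.sign (ρ v) = 1
  hcmp : ∀ (f : {f : Γ.E // f ≠ e}) (b : Bool),
    ∃ h : indCmpInt Γ e uu vv f.1 b <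
        quadBound n t m (Sum.map (· + k) μ (Γ.ep f.1 b)),
      Δ.cmp (φE f) (xor (g f.1) b) =
        ((ρ (Sum.map (· + k) μ (Γ.ep f.1 b))) ⟨indCmpInt Γ e uu vv f.1 b, h⟩ : Fin _).val

/-- induced V-orientation position for the collapse of a non-Wilson edge with
one external endpoint (fig. 6). -/
def indCmpMix {n t : ℕ} (Γ : Tri n (t+1)) (e : Γ.E) (be : Bool) (vv : Fin (t+1))
    (f : Γ.E) (b : Bool) : ℕ :=
  if Γ.ep f b = Sum.inr vv then (Γ.cmp f b + 3 - Γ.cmp e (!be)) % 3 - 1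
  else Γ.cmp f b

/-- vertex map for the collapse of an edge with an external endpoint `iu` and an
internal endpoint `vv`: `vv` is merged into the (rotated) external vertex `x`. -/
def vmapMix {n t : ℕ} (k : Fin n) (μ : Fin (t+1) → Fin t) (vv : Fin (t+1)) (x : Fin n) :
    Fin n ⊕ Fin (t+1) → Fin n ⊕ Fin t := fun w =>
  if w = Sum.inr vv then Sum.inl x else Sum.map (· + k) μ w

/-- Collapse of a non-Wilson edge `e` of `Γ` with one external endpoint `iu` and
one internal endpoint `vv`, producing `Δ` (with a distinguished 4-valent
external vertex). -/
structure CollapseMix {n t : ℕ} {m : Fin n ⊕ Fin t} (Γ : Tri n (t+1)) (e : Γ.E)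
    (Δ : BDiag n t (quadBound n t m)) where
  be : Bool
  iu : Fin n
  vv : Fin (t+1)
  hu : Γ.ep e be = Sum.inl iu
  hv : Γ.ep e (!be) = Sum.inr vv
  x : Fin n
  k : Fin n
  hx : iu + k = x
  hm : m = Sum.inl x
  μ : Fin (t+1) → Fin t
  hinj : ∀ a b : Fin (t+1), a ≠ vv → b ≠ vv → μ a = μ b → a = b
  hsurj : Function.Surjective μ
  φE : {f : Γ.E // f ≠ e} ≃ Δ.E
  g : Γ.E → Bool
  hep : ∀ (f : {f : Γ.E // f ≠ e}) (b : Bool),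
    Δ.ep (φE f) (xor (g f.1) b) = vmapMix k μ vv x (Γ.ep f.1 b)
  ρ : (v : Fin n ⊕ Fin t) → Equiv.Perm (Fin (quadBound n t m v))
  hsgn : ∏ v : Fin n ⊕ Fin t, Equiv.Perm.sign (ρ v) = 1
  hcmp : ∀ (f : {f : Γ.E // f ≠ e}) (b : Bool),
    ∃ h : indCmpMix Γ e be vv f.1 b <
        quadBound n t m (vmapMix k μ vv x (Γ.ep f.1 b)),
      Δ.cmp (φE f) (xor (g f.1) b) =
        ((ρ (vmapMix k μ vv x (Γ.ep f.1 b))) ⟨indCmpMix Γ e be vv f.1 b, h⟩ : Fin _).val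

/-- induced V-orientation position for the collapse of the Wilson edge joining
the consecutive external vertices `i0`, `i0+1` (fig. 7: the two non-Wilson ends
at the new 4-valent external vertex are ordered along the Wilson orientation). -/
def indCmpWil {n t : ℕ} (Γ : Tri (n+1) t) (i0 : Fin (n+1)) (f : Γ.E) (b : Bool) : ℕ :=
  if Γ.ep f b = Sum.inl i0 then 0
  else if Γ.ep f b = Sum.inl (i0 + 1) then 1
  else Γ.cmp f b

/-- Collapse of the Wilson edge of `Γ` joining the consecutive external vertices
`i0` and `i0+1`, producing `Δ` (with a distinguished 4-valent external vertex). -/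
structure CollapseWil {n t : ℕ} {m : Fin n ⊕ Fin t} (Γ : Tri (n+1) t) (i0 : Fin (n+1))
    (Δ : BDiag n t (quadBound n t m)) where
  x : Fin n
  hm : m = Sum.inl x
  ν : Fin (n+1) → Fin n
  hν0 : ν i0 = x
  hν1 : ν (i0 + 1) = x
  hνsucc : ∀ a : Fin (n+1), a ≠ i0 → (ν (a + 1)).val = ((ν a).val + 1) % n
  φE : Γ.E ≃ Δ.E
  g : Γ.E → Bool
  hep : ∀ (f : Γ.E) (b : Bool),
    Δ.ep (φE f) (xor (g f) b) = Sum.map ν id (Γ.ep f b)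
  ρ : (v : Fin n ⊕ Fin t) → Equiv.Perm (Fin (quadBound n t m v))
  hsgn : ∏ v : Fin n ⊕ Fin t, Equiv.Perm.sign (ρ v) = 1
  hcmp : ∀ (f : Γ.E) (b : Bool),
    ∃ h : indCmpWil Γ i0 f b < quadBound n t m (Sum.map ν id (Γ.ep f b)),
      Δ.cmp (φE f) (xor (g f) b) =
        ((ρ (Sum.map ν id (Γ.ep f b))) ⟨indCmpWil Γ i0 f b, h⟩ : Fin _).val

/- ### Packaging over all sizes -/

/-- trivalent V-oriented Wilson diagrams of arbitrary size. -/
def TriS := Σ p : ℕ × ℕ, Tri p.1 p.2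

/-- a trivalent diagram with a distinguished admissible-edge token: either a
non-Wilson edge, or the Wilson edge at position `i` (joining the external
vertices `i` and `i+1`). -/
def Pair (p : ℕ × ℕ) := Σ Γ : Tri p.1 p.2, (Γ.E ⊕ Fin p.1)

/-- pairs `(Γ, e)` of arbitrary size. -/
def SPair := Σ p : ℕ × ℕ, Pair p

/-- Wilson diagrams with one 4-valent vertex, of arbitrary size. -/
def QuadS := Σ (p : ℕ × ℕ) (m : Fin p.1 ⊕ Fin p.2), BDiag p.1 p.2 (quadBound p.1 p.2 m)

def castPair {p q : ℕ × ℕ} (h : p = q) (P : Pair p) : Pair q :=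
  cast (congrArg Pair h) P

def castTri {p q : ℕ × ℕ} (h : p = q) (Γ : Tri p.1 p.2) : Tri q.1 q.2 :=
  cast (congrArg (fun r : ℕ × ℕ => Tri r.1 r.2) h) Γ

def castQuad {p q : ℕ × ℕ} (h : p = q)
    (Q : Σ m : Fin p.1 ⊕ Fin p.2, BDiag p.1 p.2 (quadBound p.1 p.2 m)) :
    Σ m : Fin q.1 ⊕ Fin q.2, BDiag q.1 q.2 (quadBound q.1 q.2 m) :=
  cast (congrArg (fun r : ℕ × ℕ =>
    Σ m : Fin r.1 ⊕ Fin r.2, BDiag r.1 r.2 (quadBound r.1 r.2 m)) h) Q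

/-- equivalence of pairs `(Γ, e)`, via an isomorphism of V-oriented Wilson
diagrams of orientation-sign `ε` carrying the token of the first to the token
of the second. -/
def PairEquivSg (ε : ℤˣ) (P Q : SPair) : Prop :=
  ∃ h : P.1 = Q.1, ∃ φ : BIso (castPair h P.2).1 Q.2.1,
    φ.sign = ε ∧ Sum.map φ.ψ (· + φ.k) (castPair h P.2).2 = Q.2.2

/-- equivalence of pairs by an orientation-preserving isomorphism. -/
def PairEquivS (P Q : SPair) : Prop := PairEquivSg 1 P Q

/-- `CollPair P Q` : collapsing the token edge of the pair `P` yields the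
one-4-valent-vertex diagram `Q` (i.e. `δ_e Γ = Γ_x`). -/
def CollPair (P : SPair) (Q : QuadS) : Prop :=
  (∃ h : P.1 = (Q.1.1, Q.1.2 + 1),
    (match castPair h P.2 with
     | ⟨Γ, .inl e⟩ => Nonempty (CollapseInt Γ e Q.2.2) ∨ Nonempty (CollapseMix Γ e Q.2.2)
     | ⟨_, .inr _⟩ => False)) ∨
  (∃ h : P.1 = (Q.1.1 + 1, Q.1.2),
    (match castPair h P.2 with
     | ⟨Γ, .inr i0⟩ => Nonempty (CollapseWil Γ i0 Q.2.2)
     | ⟨_, .inl _⟩ => False))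

/-- isomorphism of one-4-valent-vertex diagrams with orientation-sign `ε`. -/
def QIsoSg (ε : ℤˣ) (Q Q' : QuadS) : Prop :=
  ∃ h : Q.1 = Q'.1, ∃ φ : BIso (castQuad h Q.2).2 Q'.2.2, φ.sign = ε

/-- isomorphism of the underlying (unoriented) Wilson graphs. -/
def UIsoS (Q Q' : QuadS) : Prop :=
  ∃ h : Q.1 = Q'.1, Nonempty (UIso (castQuad h Q.2).2 Q'.2.2)

/-- isomorphism of trivalent diagrams (of arbitrary sizes) of sign `ε`. -/
def TriIsoSg (ε : ℤˣ) (x y : TriS) : Prop :=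
  ∃ h : x.1 = y.1, ∃ φ : BIso (castTri h x.2) y.2, φ.sign = ε

/- ### Typed lifts: the ≤ 3 splittings of a 4-valent vertex are distinguished
   by the way the four (resp. two) slots at the 4-valent vertex are divided
   between the two endpoints of the collapsed edge. -/

/-- an internal-edge collapse in which the slots at the 4-valent vertex coming
from the `uu`-side are exactly those with positions in `S`. -/
def CollapseIntT {n t : ℕ} {m : Fin n ⊕ Fin t} (S : Finset (Fin 4))
    (Γ : Tri n (t+1)) (e : Γ.E) (Δ : BDiag n t (quadBound n t m)) : Prop :=
  ∃ c : CollapseInt Γ e Δ, S.card = 2 ∧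
    ∀ (f : {f : Γ.E // f ≠ e}) (b : Bool),
      (Γ.ep f.1 b = Sum.inr c.uu →
        ∀ h : Δ.cmp (c.φE f) (xor (c.g f.1) b) < 4, (⟨_, h⟩ : Fin 4) ∈ S) ∧
      (Γ.ep f.1 b = Sum.inr c.vv →
        ∀ h : Δ.cmp (c.φE f) (xor (c.g f.1) b) < 4, (⟨_, h⟩ : Fin 4) ∉ S)

/-- a Wilson-edge collapse in which the slot coming from the earlier external
vertex `i0` sits at position `0` (if `w`) resp. `1` (if `¬w`). -/
def CollapseWilT {n t : ℕ} {m : Fin n ⊕ Fin t} (w : Bool)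
    (Γ : Tri (n+1) t) (i0 : Fin (n+1)) (Δ : BDiag n t (quadBound n t m)) : Prop :=
  ∃ c : CollapseWil Γ i0 Δ, ∀ (f : Γ.E) (b : Bool), Γ.ep f b = Sum.inl i0 →
    Δ.cmp (c.φE f) (xor (c.g f) b) = (if w then 0 else 1)

/-- the possible splitting types of a 4-valent vertex. -/
def LiftTy := Finset (Fin 4) ⊕ (Bool ⊕ Unit)

/-- `CollPairT τ P Q` : the pair `P` collapses onto `Q` with splitting type `τ`. -/
def CollPairT (τ : LiftTy) (P : SPair) (Q : QuadS) : Prop :=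
  match τ with
  | .inl S =>
      ∃ h : P.1 = (Q.1.1, Q.1.2 + 1),
        (match castPair h P.2 with
         | ⟨Γ, .inl e⟩ => CollapseIntT S Γ e Q.2.2
         | ⟨_, .inr _⟩ => False)
  | .inr (.inl w) =>
      ∃ h : P.1 = (Q.1.1 + 1, Q.1.2),
        (match castPair h P.2 with
         | ⟨Γ, .inr i0⟩ => CollapseWilT w Γ i0 Q.2.2
         | ⟨_, .inl _⟩ => False)
  | .inr (.inr _) =>
      ∃ h : P.1 = (Q.1.1, Q.1.2 + 1),
        (match castPair h P.2 with
         | ⟨Γ, .inl e⟩ => Nonempty (CollapseMix Γ e Q.2.2)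
         | ⟨_, .inr _⟩ => False)

/-- `Q` has no self-loop (no non-Wilson edge with both ends at one vertex). -/
def noLoop (Q : QuadS) : Prop :=
  ∀ f : Q.2.2.E, Q.2.2.ep f false ≠ Q.2.2.ep f true

/-- `Q` has no double edge (no two distinct non-Wilson edges with the same pair
of endpoints). -/
def noDouble (Q : QuadS) : Prop :=
  ∀ f f' : Q.2.2.E,
    ((Q.2.2.ep f false = Q.2.2.ep f' false ∧ Q.2.2.ep f true = Q.2.2.ep f' true) ∨
     (Q.2.2.ep f false = Q.2.2.ep f' true ∧ Q.2.2.ep f true = Q.2.2.ep f' false)) → f = f'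

end
/- ## Feynman rules: configuration-space integrals of trivalent Wilson diagrams.
   The wedge of the pulled-back Gauss forms, evaluated against the orientation
   `Ω(Γ, or_Γ)` determined by the anchor (V-orientation), is expanded by the
   standard alternating-sum formula over all bijections from edge-ends to
   configuration coordinates. -/

noncomputable section

open scoped BigOperators

abbrev V3 := Fin 3 → ℝ

def dot3 (a b : V3) : ℝ := a 0 * b 0 + a 1 * b 1 + a 2 * b 2

def cross3 (a b : V3) : V3 :=
  ![a 1 * b 2 - a 2 * b 1, a 2 * b 0 - a 0 * b 2, a 0 * b 1 - a 1 * b 0]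

/-- the pullback `u^*ω` of the Gauss two-form on `S²` under `u(x) = x/|x|`,
as a bilinear form at the point `x`:  `(1/4π) ⟨x, a × b⟩ / |x|³`. -/
def gauss2 (x a b : V3) : ℝ :=
  dot3 x (cross3 a b) / (4 * Real.pi * (Real.sqrt (dot3 x x)) ^ 3)

/-- a smooth embedding `S¹ → ℝ³`, modelled as a 1-periodic smooth immersion of
`ℝ` injective on a period. -/
structure Knot where
  map : ℝ → V3
  smooth : ContDiff ℝ (⊤ : ℕ∞) map
  periodic : Function.Periodic map 1
  injOn : Set.InjOn map (Set.Ico 0 1)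
  immersed : ∀ s : ℝ, deriv map s ≠ 0

/-- the configuration space `C_{n,t}(φ)` of `n` cyclically ordered points on the
knot and `t` pairwise distinct points of `ℝ³` off the knot (the circle
parameters are lifted to a fundamental domain). -/
def Config (φ : Knot) (n t : ℕ) : Set ((Fin n → ℝ) × (Fin t → V3)) :=
  {c | StrictMono c.1 ∧ (∀ i j : Fin n, c.1 i < c.1 j + 1) ∧
       (∀ i : Fin n, 0 ≤ c.1 i) ∧ (n ≠ 0 → ∃ i0 : Fin n, c.1 i0 < 1) ∧
       Function.Injective c.2 ∧
       (∀ (i : Fin n) (j : Fin t), φ.map (c.1 i) ≠ c.2 j)}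

/-- the position in `ℝ³` of a vertex of the diagram, at a given configuration. -/
def posOf (φ : Knot) {n t : ℕ} (c : (Fin n → ℝ) × (Fin t → V3)) :
    Fin n ⊕ Fin t → V3
  | .inl i => φ.map (c.1 i)
  | .inr j => c.2 j

/-- the derivative of the position of a vertex in the direction of a tangent
vector `w` of the configuration space. -/
def dposOf (φ : Knot) {n t : ℕ} (c w : (Fin n → ℝ) × (Fin t → V3)) :
    Fin n ⊕ Fin t → V3
  | .inl i => w.1 i • deriv φ.map (c.1 i)
  | .inr j => w.2 j

/-- the standard basis tangent vector of the configuration space attached to the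
coordinate `⟨v, c⟩` (the circle parameter of an external vertex, or one of the
three space coordinates of an internal vertex). -/
def bvec {n t : ℕ} : ((v : Fin n ⊕ Fin t) × Fin (triBound n t v)) →
    (Fin n → ℝ) × (Fin t → V3)
  | ⟨.inl i, _⟩ => (Pi.single i 1, 0)
  | ⟨.inr j, c⟩ => (0, Pi.single j (Pi.single c (1 : ℝ)))

/-- the integrand of `I(Γ)(φ)`: the wedge `⋀_e φ_e^* ω` of the pulled-back Gauss
forms over all non-Wilson edges, evaluated on the standard coordinate frame
ordered by the orientation `Ω(Γ, or_Γ)` (the sum runs over all bijections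
between edge-ends and configuration coordinates, with the sign relative to the
anchor of `Γ`). -/
def integrand {n t : ℕ} (Γ : Tri n t) (φ : Knot)
    (c : (Fin n → ℝ) × (Fin t → V3)) : ℝ :=
  ∑ τ : (Γ.E × Bool) ≃ ((v : Fin n ⊕ Fin t) × Fin (triBound n t v)),
    ((Equiv.Perm.sign (τ.trans Γ.anch.symm) : ℤ) : ℝ) *
      ∏ e : Γ.E,
        gauss2 (posOf φ c (Γ.ep e true) - posOf φ c (Γ.ep e false))
          (dposOf φ c (bvec (τ (e, false))) (Γ.ep e true) -
            dposOf φ c (bvec (τ (e, false))) (Γ.ep e false))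
          (dposOf φ c (bvec (τ (e, true))) (Γ.ep e true) -
            dposOf φ c (bvec (τ (e, true))) (Γ.ep e false))

/-- the configuration-space integral `I(Γ)(φ)`. -/
def Itri {n t : ℕ} (Γ : Tri n t) (φ : Knot) : ℝ :=
  ∫ c in Config φ n t, integrand Γ φ c

end
/- ## The space of BN diagrams `A_N` and the perturbative expansion `Z_N`. -/

noncomputable section

open scoped BigOperators TensorProduct

attribute [local instance] Classical.propDecidable

/-- the degree `(n + t)/2` enters through `n + t`. -/
def degTS (x : TriS) : ℕ := x.1.1 + x.1.2

/-- trivalent V-oriented Wilson diagrams of degree `N`. -/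
def TriD (N : ℕ) := {x : TriS // degTS x = 2 * N}

/-- equivalence classes `G³_N` of V-oriented trivalent Wilson graphs of degree `N`. -/
def G3cls (N : ℕ) := Quot (fun x y : TriD N => TriIsoSg 1 x.1 y.1)

/-- the relations defining the space of BN diagrams: `Γ + (-Γ)`, together with
the STU/IHX sums `Γ_x^1 + Γ_x^2 + Γ_x^3` of the (typed) lifts of every Wilson
graph `Γ_x` of degree `N` with exactly one 4-valent vertex. -/
def ANrels (N : ℕ) : Set (G3cls N →₀ ℝ) :=
  {w | ∃ x y : TriD N, TriIsoSg (-1) x.1 y.1 ∧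
      w = Finsupp.single (Quot.mk _ x) 1 + Finsupp.single (Quot.mk _ y) 1} ∪
  {w | ∃ (Q : QuadS) (_ : Q.1.1 + Q.1.2 + 1 = 2 * N)
        (L : Fin 3 → SPair) (τ : Fin 3 → LiftTy)
        (hd : ∀ i, (L i).1.1 + (L i).1.2 = 2 * N),
      (∀ i j, i ≠ j → τ i ≠ τ j) ∧
      (∀ i, CollPairT (τ i) (L i) Q) ∧
      (∀ P : SPair, CollPair P Q → ∃ i, PairEquivS P (L i)) ∧
      w = ∑ i : Fin 3,
        Finsupp.single
          (Quot.mk _ (⟨⟨(L i).1, (L i).2.1⟩, hd i⟩ : TriD N)) 1}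

/-- the space `A_N` of BN diagrams of degree `N`. -/
def AN (N : ℕ) : Type 1 := (G3cls N →₀ ℝ) ⧸ Submodule.span ℝ (ANrels N)

instance (N : ℕ) : AddCommGroup (AN N) := Submodule.Quotient.addCommGroup _
instance (N : ℕ) : Module ℝ (AN N) := Submodule.Quotient.module _

/-- the projection `D` onto the space of BN diagrams. -/
def Dmap {N : ℕ} (x : TriD N) : AN N :=
  Submodule.Quotient.mk (Finsupp.single (Quot.mk _ x) (1 : ℝ))

/-- a choice of representative of each equivalence class. -/
def reprOf {N : ℕ} (c : G3cls N) : TriD N := (Quot.exists_rep c).choose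

/-- the degree-`N` part of the perturbative expansion of the expectation value
of the Wilson loop:  `Z_N(φ) = Σ_{Γ ∈ G³_N} (I(Γ)(φ)/|Aut Γ|) · D(Γ)`. -/
def ZN (N : ℕ) (φ : Knot) : AN N :=
  ∑ᶠ c : G3cls N,
    (((Nat.card (GAuto (reprOf c).1.2) : ℝ))⁻¹ * Itri (reprOf c).1.2 φ) • Dmap (reprOf c)

/- ### The space `B_N` spanned by the one-4-valent-vertex diagrams. -/

/-- one-4-valent-vertex diagrams of degree `N`. -/
def QuadD (N : ℕ) := {Q : QuadS // Q.1.1 + Q.1.2 + 1 = 2 * N}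

/-- their equivalence classes. -/
def QCls (N : ℕ) := Quot (fun x y : QuadD N => QIsoSg 1 x.1 y.1)

/-- relations: `Γ' + (-Γ')`, diagrams with a self-loop, diagrams with a double
edge. -/
def BNrels (N : ℕ) : Set (QCls N →₀ ℝ) :=
  {w | ∃ x y : QuadD N, QIsoSg (-1) x.1 y.1 ∧
      w = Finsupp.single (Quot.mk _ x) 1 + Finsupp.single (Quot.mk _ y) 1} ∪
  {w | ∃ x : QuadD N, ¬ noLoop x.1 ∧ w = Finsupp.single (Quot.mk _ x) 1} ∪
  {w | ∃ x : QuadD N, ¬ noDouble x.1 ∧ w = Finsupp.single (Quot.mk _ x) 1}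

def BN (N : ℕ) : Type 1 := (QCls N →₀ ℝ) ⧸ Submodule.span ℝ (BNrels N)

instance (N : ℕ) : AddCommGroup (BN N) := Submodule.Quotient.addCommGroup _
instance (N : ℕ) : Module ℝ (BN N) := Submodule.Quotient.module _

/-- the class `[Γ']` of a one-4-valent-vertex diagram in `B_N`. -/
def Bmap {N : ℕ} (x : QuadD N) : BN N :=
  Submodule.Quotient.mk (Finsupp.single (Quot.mk _ x) (1 : ℝ))

end
section MirrorImage

open MeasureTheory

theorem gauss2_neg_smul_smul (x a b : V3) (r s : ℝ) :
    gauss2 (-x) (r • a) (s • b) = -(r * s) * gauss2 x a b := by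
  have h : dot3 (-x) (-x) = dot3 x x := by simp [dot3]
  have h' : dot3 (-x) (cross3 (r • a) (s • b)) = -(r * s) * dot3 x (cross3 a b) := by
    simp [dot3, cross3]
    ring
  rw [gauss2, gauss2, h, h', mul_div_assoc]

/-- The reflection `x ↦ -x` of the internal points of a configuration. -/
def reflectInternal {n t : ℕ} (c : (Fin n → ℝ) × (Fin t → V3)) :
    (Fin n → ℝ) × (Fin t → V3) := (c.1, -c.2)

/-- The sign `-1` at external vertices and `1` at internal ones. -/
def externalSign {n t : ℕ} : Fin n ⊕ Fin t → ℝ := Sum.elim (fun _ => -1) (fun _ => 1)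

theorem prod_externalSign (n t : ℕ) :
    ∏ s : (v : Fin n ⊕ Fin t) × Fin (triBound n t v), externalSign s.1 = (-1) ^ n := by
  rw [Fintype.prod_sigma, Fintype.prod_sum_type]
  simp only [externalSign, Sum.elim_inl, Sum.elim_inr, Finset.prod_const, Finset.card_univ,
    Fintype.card_fin]
  simp [triBound]

theorem card_edges_tri {n t : ℕ} (Γ : Tri n t) : Fintype.card Γ.E * 2 = n + 3 * t := by
  have h := Fintype.card_congr Γ.anch
  rw [Fintype.card_prod, Fintype.card_bool, Fintype.card_sigma, Fintype.sum_sum_type] at h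
  simp only [Fintype.card_fin] at h
  simpa [triBound, mul_comm] using h

theorem posOf_mirror {φ ψ : Knot} (hmir : ∀ s : ℝ, ψ.map s = -(φ.map s)) {n t : ℕ}
    (c : (Fin n → ℝ) × (Fin t → V3)) (v : Fin n ⊕ Fin t) :
    posOf ψ (reflectInternal c) v = -posOf φ c v := by
  cases v <;> simp [posOf, reflectInternal, hmir]

theorem deriv_mirror {φ ψ : Knot} (hmir : ∀ s : ℝ, ψ.map s = -(φ.map s)) (s : ℝ) :
    deriv ψ.map s = -deriv φ.map s := by
  rw [show ψ.map = -φ.map from funext hmir, deriv.neg]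

theorem dposOf_bvec_mirror {φ ψ : Knot} (hmir : ∀ s : ℝ, ψ.map s = -(φ.map s)) {n t : ℕ}
    (c : (Fin n → ℝ) × (Fin t → V3))
    (s : (v : Fin n ⊕ Fin t) × Fin (triBound n t v))
    (v : Fin n ⊕ Fin t) :
    dposOf ψ (reflectInternal c) (bvec s) v = externalSign s.1 • dposOf φ c (bvec s) v := by
  obtain ⟨i | j, a⟩ := s <;> cases v <;>
    simp [dposOf, bvec, externalSign, reflectInternal, deriv_mirror hmir]

theorem integrand_mirror {φ ψ : Knot} (hmir : ∀ s : ℝ, ψ.map s = -(φ.map s)) {n t : ℕ}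
    (c : (Fin n → ℝ) × (Fin t → V3)) (Γ : Tri n t) :
    integrand Γ ψ (reflectInternal c) =
      ((-1) ^ Fintype.card Γ.E * (-1) ^ n) * integrand Γ φ c := by
  rw [integrand, integrand, Finset.mul_sum]
  refine Finset.sum_congr rfl fun τ _ => ?_
  have hprod : ∏ e : Γ.E, -(externalSign (τ (e, false)).1 * externalSign (τ (e, true)).1) =
      (-1) ^ Fintype.card Γ.E * (-1) ^ n := by
    rw [Finset.prod_neg, Finset.card_univ, ← prod_externalSign n t,
      ← Equiv.prod_comp τ, Fintype.prod_prod_type]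
    simp [mul_comm]
  rw [← hprod, mul_left_comm, ← Finset.prod_mul_distrib]
  congr 1
  refine Finset.prod_congr rfl fun e _ => ?_
  simp only [posOf_mirror hmir, dposOf_bvec_mirror hmir, ← smul_sub, ← gauss2_neg_smul_smul]
  congr 1
  abel

theorem reflectInternal_mem_config_mirror {φ ψ : Knot}
    (hmir : ∀ s : ℝ, ψ.map s = -(φ.map s)) {n t : ℕ} (c : (Fin n → ℝ) × (Fin t → V3)) :
    reflectInternal c ∈ Config ψ n t ↔ c ∈ Config φ n t := by
  have hinj : Function.Injective (-c.2) ↔ Function.Injective c.2 :=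
    neg_injective.of_comp_iff c.2
  simp [Config, reflectInternal, hmir, hinj]

theorem measurePreserving_reflectInternal (n t : ℕ) :
    MeasurePreserving (reflectInternal (n := n) (t := t)) :=
  (MeasurePreserving.id volume).prod (Measure.measurePreserving_neg volume)

theorem measurableEmbedding_reflectInternal (n t : ℕ) :
    MeasurableEmbedding (reflectInternal (n := n) (t := t)) :=
  ((MeasurableEquiv.refl _).prodCongr (MeasurableEquiv.neg _)).measurableEmbedding

theorem Itri_mirror {φ ψ : Knot} (hmir : ∀ s : ℝ, ψ.map s = -(φ.map s)) {n t : ℕ}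
    (Γ : Tri n t) :
    Itri Γ ψ = ((-1) ^ Fintype.card Γ.E * (-1) ^ n) * Itri Γ φ := by
  have hpre : reflectInternal ⁻¹' Config ψ n t = Config φ n t :=
    Set.ext (reflectInternal_mem_config_mirror hmir)
  rw [Itri, Itri, ← (measurePreserving_reflectInternal n t).setIntegral_preimage_emb
    (measurableEmbedding_reflectInternal n t), hpre]
  simp only [integrand_mirror hmir]
  exact integral_const_mul _ _

theorem Itri_mirror_of_degTS {φ ψ : Knot} (hmir : ∀ s : ℝ, ψ.map s = -(φ.map s)) {N : ℕ}
    (x : TriD N) : Itri x.1.2 ψ = (-1) ^ N * Itri x.1.2 φ := by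
  rw [Itri_mirror hmir, ← pow_add]
  congr 1
  have hcard := card_edges_tri x.1.2
  have hdeg : x.1.1.1 + x.1.1.2 = 2 * N := x.2
  rw [show Fintype.card x.1.2.E + x.1.1.1 = N + 2 * N by omega, pow_add]
  simp

end MirrorImage

/- STATEMENT 13: `Z_N(φ*) = (-1)^N Z_N(φ)` in `A_N`: the perturbative
Chern-Simons expansion satisfies `Z(φ*)(ħ) = Z(φ)(-ħ)`, so its even-order terms
cannot distinguish a knot from its mirror image. -/
theorem ZN_mirror (N : ℕ) (hN : 1 ≤ N) (φ ψ : Knot)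
    (hmir : ∀ s : ℝ, ψ.map s = -(φ.map s)) :
    ZN N ψ = ((-1 : ℝ) ^ N) • ZN N φ := by
  rw [ZN, ZN, smul_finsum]
  refine finsum_congr fun c => ?_
  rw [Itri_mirror_of_degTS hmir, smul_smul, mul_left_comm]
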